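/- arXiv:1608.00875 — 2 statements merged into one kernel-verified Lean document; each statement's English description precedes it below -/
import Mathlib

section
/- The operators e_n satisfy the cubic relation 3[e_2, e_1] − [e_3, e_0] + (ħ² + t(ħ+t))[e_1, e_0] + ħt(ħ+t)·e_0² = 0 as k₀-linear endomorphisms of K. -/
/-!
Setup: `k0 l` is the field k₀ = ℂ(ħ, t, z₁, …, z_l) and `KK l N` is the field
K = ℂ(ħ, t, z₁, …, z_l, w₁, …, w_N), realized as the rational function field in
w₁, …, w_N over k₀.  Operators are k₀-linear endomorphisms of K, products of
operators denote composition, and `[A, B] = A * B - B * A`.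
-/

open MvPolynomial Finset

set_option synthInstance.maxHeartbeats 1000000
set_option maxHeartbeats 2000000

noncomputable section

/-- The coefficient field k₀ = ℂ(ħ, t, z₁, …, z_l). -/
def k0 (l : ℕ) : Type := FractionRing (MvPolynomial (Fin 2 ⊕ Fin l) ℂ)

instance (l : ℕ) : Field (k0 l) := inferInstanceAs (Field (FractionRing _))
instance (l : ℕ) : Algebra (MvPolynomial (Fin 2 ⊕ Fin l) ℂ) (k0 l) :=
  inferInstanceAs (Algebra _ (FractionRing _))
instance (l : ℕ) : IsFractionRing (MvPolynomial (Fin 2 ⊕ Fin l) ℂ) (k0 l) :=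
  inferInstanceAs (IsFractionRing _ (FractionRing _))
instance (l : ℕ) : CharZero (k0 l) :=
  charZero_of_injective_algebraMap
    (IsFractionRing.injective (MvPolynomial (Fin 2 ⊕ Fin l) ℂ) (k0 l))

/-- The field K = ℂ(ħ, t, z₁, …, z_l, w₁, …, w_N), as k₀(w₁, …, w_N). -/
def KK (l N : ℕ) : Type := FractionRing (MvPolynomial (Fin N) (k0 l))

instance (l N : ℕ) : Field (KK l N) := inferInstanceAs (Field (FractionRing _))
instance (l N : ℕ) : Algebra (MvPolynomial (Fin N) (k0 l)) (KK l N) :=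
  inferInstanceAs (Algebra _ (FractionRing _))
instance (l N : ℕ) : IsFractionRing (MvPolynomial (Fin N) (k0 l)) (KK l N) :=
  inferInstanceAs (IsFractionRing _ (FractionRing _))
instance (l N : ℕ) : Algebra (k0 l) (KK l N) :=
  inferInstanceAs (Algebra _ (FractionRing (MvPolynomial (Fin N) (k0 l))))
instance (l N : ℕ) : IsScalarTower (k0 l) (MvPolynomial (Fin N) (k0 l)) (KK l N) :=
  inferInstanceAs (IsScalarTower _ _ (FractionRing _))
instance (l N : ℕ) : CharZero (KK l N) :=
  charZero_of_injective_algebraMap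
    (IsFractionRing.injective (MvPolynomial (Fin N) (k0 l)) (KK l N))

variable (l N : ℕ)

/-- ħ as an element of k₀. -/
def hb0 : k0 l := algebraMap (MvPolynomial (Fin 2 ⊕ Fin l) ℂ) (k0 l) (X (Sum.inl 0))
/-- t as an element of k₀. -/
def tt0 : k0 l := algebraMap (MvPolynomial (Fin 2 ⊕ Fin l) ℂ) (k0 l) (X (Sum.inl 1))
/-- z_k as an element of k₀. -/
def zz0 (k : Fin l) : k0 l := algebraMap (MvPolynomial (Fin 2 ⊕ Fin l) ℂ) (k0 l) (X (Sum.inr k))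

/-- ħ as an element of K. -/
def hbar : KK l N := algebraMap (k0 l) (KK l N) (hb0 l)
/-- t as an element of K. -/
def tt : KK l N := algebraMap (k0 l) (KK l N) (tt0 l)
/-- z_k as an element of K. -/
def zz (k : Fin l) : KK l N := algebraMap (k0 l) (KK l N) (zz0 l k)
/-- w_i as an element of K. -/
def ww (i : Fin N) : KK l N := algebraMap (MvPolynomial (Fin N) (k0 l)) (KK l N) (X i)

/-- The ring of k₀-linear endomorphisms of K; multiplication is composition. -/
abbrev Op (l N : ℕ) := Module.End (k0 l) (KK l N)

/-- The multiplication operator by an element of K. -/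
def mulOp (a : KK l N) : Op l N := LinearMap.mulLeft (k0 l) a

/-- w̄_i = w_i − (N−1)t (here l = 0, so K = ℂ(ħ, t, w₁, …, w_N)). -/
def wbar (i : Fin N) : KK 0 N := ww 0 N i - ((N - 1 : ℕ) : KK 0 N) * tt 0 N

variable (u : Fin N → (KK 0 N ≃ₐ[k0 0] KK 0 N))

/-- The operator e_n. -/
def eop (n : ℕ) : Op 0 N :=
  ∑ i : Fin N,
    mulOp 0 N ((wbar N i + hbar 0 N) ^ n *
      ∏ j ∈ ({i}ᶜ : Finset (Fin N)), (wbar N i - wbar N j - tt 0 N) / (wbar N i - wbar N j)) *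
      (u i).toLinearMap

/-- The operator f_n. -/
def fop (n : ℕ) : Op 0 N :=
  ∑ i : Fin N,
    mulOp 0 N ((wbar N i) ^ n *
      ∏ j ∈ ({i}ᶜ : Finset (Fin N)), (wbar N i - wbar N j + tt 0 N) / (wbar N i - wbar N j)) *
      (u i).symm.toLinearMap

/-- A sum over pairs of an antisymmetric function vanishes. -/
theorem sum_sum_eq_zero_of_antisymm {ι L : Type*} [Fintype ι] [Field L] [CharZero L]
    (T : ι → ι → L) (hT : ∀ i k, T i k = -T k i) : ∑ i, ∑ k, T i k = 0 := by
  have h : ∑ i, ∑ k, T i k = -∑ i, ∑ k, T i k := by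
    conv_lhs => rw [Finset.sum_comm]
    rw [← Finset.sum_neg_distrib]
    refine Finset.sum_congr rfl fun i _ => ?_
    rw [← Finset.sum_neg_distrib]
    exact Finset.sum_congr rfl fun k _ => hT k i
  exact self_eq_neg.mp h

section ShiftOperators

variable {ι L : Type*} [Fintype ι] [DecidableEq ι] [Field L]

/-- The rational factor `∏_{j ≠ i} (x_i - x_j - t) / (x_i - x_j)`. -/
def shiftCoeff (x : ι → L) (t : L) (i : ι) : L :=
  ∏ j ∈ ({i}ᶜ : Finset ι), (x i - x j - t) / (x i - x j)

/-- The factor `∏_{j ≠ i, k} (x_i - x_j - t) / (x_i - x_j)`. -/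
def shiftCoeffErase (x : ι → L) (t : L) (i k : ι) : L :=
  ∏ j ∈ ({i, k}ᶜ : Finset ι), (x i - x j - t) / (x i - x j)

theorem shiftCoeff_eq_mul (x : ι → L) (t : L) {i k : ι} (hik : i ≠ k) :
    shiftCoeff x t i = (x i - x k - t) / (x i - x k) * shiftCoeffErase x t i k := by
  have h : ({i}ᶜ : Finset ι) = insert k ({i, k}ᶜ : Finset ι) := by
    ext j
    by_cases hj : j = k
    · simp [hj, hik.symm]
    · simp [hj]
  rw [shiftCoeff, h, Finset.prod_insert (by simp), shiftCoeffErase]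

/-- The polynomial governing the cubic relation. -/
def cubicKernel (h t a b : L) : L :=
  3 * (a ^ 2 * b - a * b ^ 2) - (a ^ 3 - b ^ 3)
    + (h ^ 2 + t * (h + t)) * (a - b) + h * t * (h + t)

variable (σ : ι → L →+* L) (x : ι → L) (h t : L)

theorem map_shiftCoeff_eq_mul (hx : ∀ i j, σ i (x j) = x j + if j = i then h else 0)
    (ht : ∀ i, σ i t = t) {i k : ι} (hik : i ≠ k) :
    σ i (shiftCoeff x t k) =
      (x k - (x i + h) - t) / (x k - (x i + h)) * shiftCoeffErase x t k i := by
  rw [shiftCoeff_eq_mul x t hik.symm, map_mul, shiftCoeffErase, map_prod]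
  congr 1
  · simp [hx, ht, hik.symm]
  · refine Finset.prod_congr rfl fun j hj => ?_
    have hj' : j ≠ i := fun e => by simp [e] at hj
    simp [hx, ht, hik.symm, hj']

theorem cubicKernel_mul_antisymm (hx : ∀ i j, σ i (x j) = x j + if j = i then h else 0)
    (hh : ∀ i, σ i h = h) (ht : ∀ i, σ i t = t)
    (hσ : ∀ i j f, σ i (σ j f) = σ j (σ i f)) (f : L) (i k : ι) :
    cubicKernel h t (x i + h) (σ i (x k + h)) *
        (shiftCoeff x t i * σ i (shiftCoeff x t k)) * σ i (σ k f) =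
      -(cubicKernel h t (x k + h) (σ k (x i + h)) *
        (shiftCoeff x t k * σ k (shiftCoeff x t i)) * σ k (σ i f)) := by
  by_cases hik : i = k
  · subst hik
    have : cubicKernel h t (x i + h) (σ i (x i + h)) = 0 := by
      simp only [map_add, hx, hh, if_true, cubicKernel]
      ring
    rw [this]
    ring
  · have hki : k ≠ i := Ne.symm hik
    rw [map_shiftCoeff_eq_mul σ x h t hx ht hik, map_shiftCoeff_eq_mul σ x h t hx ht hki,
      shiftCoeff_eq_mul x t hik, shiftCoeff_eq_mul x t hki, hσ k i]
    simp only [map_add, hx, hh, if_neg hik, if_neg hki, add_zero]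
    by_cases hd : x i - x k = 0
    · have hd' : x k - x i = 0 := by linear_combination -hd
      simp [hd, hd']
    have hd' : x k - x i ≠ 0 := fun e => hd (by linear_combination -e)
    -- A zero denominator would be shifted by `σ`, forcing `h = 0` and `x i = x k`.
    have key : ∀ {a b : ι}, a ≠ b → x a - x b ≠ 0 → x b - (x a + h) ≠ 0 := by
      intro a b hab hne e
      have e' := congrArg (σ a) e
      simp only [map_sub, map_add, map_zero, hx, hh, if_neg hab.symm, if_true, add_zero] at e'
      exact hne (by linear_combination -2 * e + e')
    have h1 := key hik hd
    have h2 := key hki hd'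
    have aux : ∀ {a b : ι}, x a - x b ≠ 0 → x b - (x a + h) ≠ 0 →
        cubicKernel h t (x a + h) (x b + h) * ((x a - x b - t) / (x a - x b) *
          ((x b - (x a + h) - t) / (x b - (x a + h)))) =
        -((x a - x b - h - t) * (x a - x b + t) * (x a - x b - t) * (x a - x b + h + t))
          / (x a - x b) := by
      intro a b hne hne'
      rw [div_mul_div_comm, mul_div_assoc', div_eq_div_iff (mul_ne_zero hne hne') hne, cubicKernel]
      ring
    have a1 := aux hd h1
    have a2 := aux hd' h2
    have a3 : -((x k - x i - h - t) * (x k - x i + t) * (x k - x i - t) * (x k - x i + h + t))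
          / (x k - x i) =
        -(-((x i - x k - h - t) * (x i - x k + t) * (x i - x k - t) * (x i - x k + h + t))
          / (x i - x k)) := by
      rw [← neg_div, div_eq_div_iff hd' hd]
      ring
    rw [a3, ← a1] at a2
    linear_combination (shiftCoeffErase x t i k * shiftCoeffErase x t k i * σ i (σ k f)) * a2

end ShiftOperators

/-- Algebra endomorphisms of `K` that agree on the `w_j` are equal. -/
theorem algHom_KK_ext {l N : ℕ} {φ ψ : KK l N →ₐ[k0 l] KK l N}
    (hφ : ∀ j, φ (ww l N j) = ψ (ww l N j)) : φ = ψ := by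
  have hp : φ.comp (IsScalarTower.toAlgHom (k0 l) (MvPolynomial (Fin N) (k0 l)) (KK l N)) =
      ψ.comp (IsScalarTower.toAlgHom (k0 l) (MvPolynomial (Fin N) (k0 l)) (KK l N)) :=
    MvPolynomial.algHom_ext hφ
  have hr : (φ : KK l N →+* KK l N) = ψ :=
    IsLocalization.ringHom_ext (nonZeroDivisors (MvPolynomial (Fin N) (k0 l)))
      (RingHom.ext fun p => DFunLike.congr_fun hp p)
  exact AlgHom.ext fun f => DFunLike.congr_fun hr f

theorem shift_wbar {N : ℕ} {u : Fin N → (KK 0 N ≃ₐ[k0 0] KK 0 N)}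
    (hu : ∀ i j, u i (ww 0 N j) = ww 0 N j + if j = i then hbar 0 N else 0) (i j : Fin N) :
    u i (wbar N j) = wbar N j + if j = i then hbar 0 N else 0 := by
  have ht : u i (tt 0 N) = tt 0 N := (u i).commutes _
  rw [wbar, map_sub, map_mul, map_natCast, ht, hu]
  ring

theorem shift_comm {N : ℕ} {u : Fin N → (KK 0 N ≃ₐ[k0 0] KK 0 N)}
    (hu : ∀ i j, u i (ww 0 N j) = ww 0 N j + if j = i then hbar 0 N else 0)
    (i j : Fin N) (f : KK 0 N) : u i (u j f) = u j (u i f) := by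
  have hh : ∀ i, u i (hbar 0 N) = hbar 0 N := fun i => (u i).commutes _
  have h : (u i).toAlgHom.comp (u j).toAlgHom =
      (u j).toAlgHom.comp (u i).toAlgHom := by
    refine algHom_KK_ext fun m => ?_
    change u i (u j (ww 0 N m)) = u j (u i (ww 0 N m))
    rw [hu, hu, map_add, map_add, hu, hu, apply_ite (u i), apply_ite (u j), hh, hh, map_zero,
      map_zero]
    ring
  exact DFunLike.congr_fun h f

theorem eop_apply {N : ℕ} (u : Fin N → (KK 0 N ≃ₐ[k0 0] KK 0 N)) (n : ℕ) (f : KK 0 N) :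
    eop N u n f =
      ∑ i, (wbar N i + hbar 0 N) ^ n * shiftCoeff (wbar N) (tt 0 N) i * u i f := by
  rw [eop, LinearMap.sum_apply]
  rfl

theorem eop_eop_apply {N : ℕ} (u : Fin N → (KK 0 N ≃ₐ[k0 0] KK 0 N)) (m n : ℕ) (f : KK 0 N) :
    eop N u m (eop N u n f) =
      ∑ i, ∑ k, (wbar N i + hbar 0 N) ^ m * (u i (wbar N k + hbar 0 N)) ^ n *
        (shiftCoeff (wbar N) (tt 0 N) i * u i (shiftCoeff (wbar N) (tt 0 N) k)) *
        u i (u k f) := by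
  rw [eop_apply]
  refine Finset.sum_congr rfl fun i _ => ?_
  rw [eop_apply, map_sum, Finset.mul_sum]
  refine Finset.sum_congr rfl fun k _ => ?_
  rw [map_mul, map_mul, map_pow]
  ring

theorem statement7 (hN : 1 ≤ N)
    (hu : ∀ i j, u i (ww 0 N j) = ww 0 N j + if j = i then hbar 0 N else 0) :
    3 • (eop N u 2 * eop N u 1 - eop N u 1 * eop N u 2)
      - (eop N u 3 * eop N u 0 - eop N u 0 * eop N u 3)
      + mulOp 0 N (hbar 0 N ^ 2 + tt 0 N * (hbar 0 N + tt 0 N)) *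
          (eop N u 1 * eop N u 0 - eop N u 0 * eop N u 1)
      + mulOp 0 N (hbar 0 N * tt 0 N * (hbar 0 N + tt 0 N)) * (eop N u 0) ^ 2 = 0 := by
  refine LinearMap.ext fun f => ?_
  simp only [LinearMap.add_apply, LinearMap.sub_apply, LinearMap.smul_apply, Module.End.mul_apply,
    mulOp, LinearMap.mulLeft_apply, pow_two (eop N u 0), LinearMap.zero_apply]
  refine Eq.trans ?_ (sum_sum_eq_zero_of_antisymm _ (cubicKernel_mul_antisymm
    (fun i => ((u i : KK 0 N →ₐ[k0 0] KK 0 N) : KK 0 N →+* KK 0 N)) (wbar N) (hbar 0 N) (tt 0 N)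
    (shift_wbar hu) (fun i => (u i).commutes _) (fun i => (u i).commutes _) (shift_comm hu) f))
  simp only [eop_eop_apply, nsmul_eq_mul, mul_sub, Finset.mul_sum, ← Finset.sum_sub_distrib,
    ← Finset.sum_add_distrib]
  refine Finset.sum_congr rfl fun i _ => Finset.sum_congr rfl fun k _ => ?_
  simp only [cubicKernel, RingHom.coe_coe]
  push_cast
  ring
end
end

section
/- The operators f_n satisfy the Serre-type relation [f_0, [f_0, f_1]] = 0 as k₀-linear endomorphisms of K. -/
/-!
Setup: `k0 l` is the field k₀ = ℂ(ħ, t, z₁, …, z_l) and `KK l N` is the field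
K = ℂ(ħ, t, z₁, …, z_l, w₁, …, w_N), realized as the rational function field in
w₁, …, w_N over k₀.  Operators are k₀-linear endomorphisms of K, products of
operators denote composition, and `[A, B] = A * B - B * A`.
-/

open MvPolynomial Finset

set_option synthInstance.maxHeartbeats 1000000
set_option maxHeartbeats 2000000

noncomputable section

variable (l N : ℕ)

variable (u : Fin N → (KK 0 N ≃ₐ[k0 0] KK 0 N))

/-- The rational function `(x - y + t) / (x - y)`. -/
def shiftRatio {K : Type*} [Field K] (t x y : K) : K := (x - y + t) / (x - y)

lemma map_shiftRatio {K L : Type*} [Field K] [Field L] (f : K →+* L) (t x y : K) :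
    f (shiftRatio t x y) = shiftRatio (f t) (f x) (f y) := by
  simp [shiftRatio]

/-- The factor relating the composite of two difference operators to the product of the shifts. -/
def serreFactor {K : Type*} [Field K] (h t x y : K) : K :=
  shiftRatio t x y * shiftRatio t y (x - h)

lemma serreFactor_eq {K : Type*} [Field K] {h x y : K} (t : K)
    (hxy : (x - y) * (x - y - h) * (x - y + h) ≠ 0) :
    serreFactor h t x y = (x - y + t) * (x - y - h - t) * (x - y + h)
      / ((x - y) * (x - y - h) * (x - y + h)) := by
  have h3 := right_ne_zero_of_mul hxy
  have h1 := left_ne_zero_of_mul (left_ne_zero_of_mul hxy)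
  have h2 := right_ne_zero_of_mul (left_ne_zero_of_mul hxy)
  have e : y - (x - h) = -(x - y - h) := by ring
  rw [serreFactor, shiftRatio, shiftRatio, e]
  field_simp
  ring

lemma serreFactor_swap_eq {K : Type*} [Field K] {h x y : K} (t : K)
    (hxy : (x - y) * (x - y - h) * (x - y + h) ≠ 0) :
    serreFactor h t y x = (x - y - t) * (x - y + h + t) * (x - y - h)
      / ((x - y) * (x - y - h) * (x - y + h)) := by
  have hyx : (y - x) * (y - x - h) * (y - x + h) ≠ 0 := by
    intro h0; apply hxy; linear_combination -h0
  rw [serreFactor_eq t hyx, div_eq_div_iff hyx hxy]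
  ring

lemma serre_identity {K : Type*} [Field K] {h x y z : K} (t : K)
    (hxy : (x - y) * (x - y - h) * (x - y + h) ≠ 0)
    (hxz : (x - z) * (x - z - h) * (x - z + h) ≠ 0)
    (hyz : (y - z) * (y - z - h) * (y - z + h) ≠ 0) :
    (z - 2 * y + x) * (serreFactor h t x y * serreFactor h t x z * serreFactor h t y z)
    + (y - 2 * z + x) * (serreFactor h t x z * serreFactor h t x y * serreFactor h t z y)
    + (z - 2 * x + y) * (serreFactor h t y x * serreFactor h t y z * serreFactor h t x z)
    + (x - 2 * z + y) * (serreFactor h t y z * serreFactor h t y x * serreFactor h t z x)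
    + (y - 2 * x + z) * (serreFactor h t z x * serreFactor h t z y * serreFactor h t x y)
    + (x - 2 * y + z) * (serreFactor h t z y * serreFactor h t z x * serreFactor h t y x) = 0 := by
  rw [serreFactor_swap_eq t hxy, serreFactor_swap_eq t hxz, serreFactor_swap_eq t hyz,
    serreFactor_eq t hxy, serreFactor_eq t hxz, serreFactor_eq t hyz]
  generalize (x - y) * (x - y - h) * (x - y + h) = A
  generalize (x - z) * (x - z - h) * (x - z + h) = B
  generalize (y - z) * (y - z - h) * (y - z + h) = C
  obtain ⟨a, rfl⟩ : ∃ a, x = y + a := ⟨x - y, by ring⟩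
  obtain ⟨b, rfl⟩ : ∃ b, y = z + b := ⟨y - z, by ring⟩
  have e1 : z + b + a - (z + b) = a := by ring
  have e2 : z + b + a - z = a + b := by ring
  have e3 : z + b - z = b := by ring
  rw [e1, e2, e3]
  have key :
      (a - b) * ((a + t) * (a - h - t) * (a + h)) * ((a + b + t) * (a + b - h - t) * (a + b + h))
        * ((b + t) * (b - h - t) * (b + h))
      + (a + 2 * b) * ((a + t) * (a - h - t) * (a + h))
        * ((a + b + t) * (a + b - h - t) * (a + b + h)) * ((b - t) * (b + h + t) * (b - h))
      + (-2 * a - b) * ((a - t) * (a + h + t) * (a - h))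
        * ((a + b + t) * (a + b - h - t) * (a + b + h)) * ((b + t) * (b - h - t) * (b + h))
      + (a + 2 * b) * ((a - t) * (a + h + t) * (a - h))
        * ((a + b - t) * (a + b + h + t) * (a + b - h)) * ((b + t) * (b - h - t) * (b + h))
      + (-2 * a - b) * ((a + t) * (a - h - t) * (a + h))
        * ((a + b - t) * (a + b + h + t) * (a + b - h)) * ((b - t) * (b + h + t) * (b - h))
      + (a - b) * ((a - t) * (a + h + t) * (a - h))
        * ((a + b - t) * (a + b + h + t) * (a + b - h)) * ((b - t) * (b + h + t) * (b - h))
      = 0 := by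
    ring
  generalize (a + t) * (a - h - t) * (a + h) = P at *
  generalize (a - t) * (a + h + t) * (a - h) = P' at *
  generalize (a + b + t) * (a + b - h - t) * (a + b + h) = Q at *
  generalize (a + b - t) * (a + b + h + t) * (a + b - h) = Q' at *
  generalize (b + t) * (b - h - t) * (b + h) = R at *
  generalize (b - t) * (b + h + t) * (b - h) = R' at *
  linear_combination (A⁻¹ * B⁻¹ * C⁻¹) * key

lemma serre_identity_repeated {K : Type*} [Field K] {h t x y : K} (n0 : x - y ≠ 0)
    (n1 : x - y + h ≠ 0) (n2 : x - y - h ≠ 0) (n3 : x - y - 2 * h ≠ 0) :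
    (y - x + 2 * h)
        * (shiftRatio t x y * shiftRatio t (x - h) y * shiftRatio t y (x - h - h))
    + (2 * (x - y) - h)
        * (shiftRatio t x y * shiftRatio t y (x - h) * shiftRatio t (x - h) (y - h))
    + (y - x - h)
        * (shiftRatio t y x * shiftRatio t x (y - h) * shiftRatio t (x - h) (y - h)) = 0 := by
  simp only [shiftRatio]
  have e1 : x - h - y = x - y - h := by ring
  have e2 : y - (x - h - h) = -(x - y - 2 * h) := by ring
  have e3 : y - (x - h) = -(x - y - h) := by ring
  have e4 : x - h - (y - h) = x - y := by ring
  have e5 : y - x = -(x - y) := by ring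
  have e6 : x - (y - h) = x - y + h := by ring
  rw [e1, e2, e3, e4, e6, e5]
  generalize x - y = d at *
  field_simp
  ring

/-- A family of commuting endomorphisms `σ i` of a field, where `σ i` shifts `x i` by `-h`. -/
structure ShiftSystem (ι K : Type*) [DecidableEq ι] [Field K] where
  x : ι → K
  h : K
  t : K
  σ : ι → K →+* K
  σ_x : ∀ i j, σ i (x j) = x j - if j = i then h else 0
  σ_h : ∀ i, σ i h = h
  σ_t : ∀ i, σ i t = t
  σ_comm : ∀ i j a, σ i (σ j a) = σ j (σ i a)
  sub_add_ne_zero : ∀ i j, i ≠ j → ∀ n : ℤ, x i - x j + n * h ≠ 0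

namespace ShiftSystem

variable {ι K : Type*} [DecidableEq ι] [Field K] (S : ShiftSystem ι K)

/-- The product of the factors `shiftRatio t (x i) (x j)` over `j ∈ s`. -/
def coeff (i : ι) (s : Finset ι) : K :=
  ∏ j ∈ s, shiftRatio S.t (S.x i) (S.x j)

lemma σ_x_self (i : ι) : S.σ i (S.x i) = S.x i - S.h := by simp [S.σ_x]

lemma σ_x_of_ne {i j : ι} (hij : i ≠ j) : S.σ i (S.x j) = S.x j := by
  simp [S.σ_x, hij.symm]

lemma σ_coeff {i k : ι} {s : Finset ι} (hki : k ≠ i) (hks : k ∉ s) :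
    S.σ k (S.coeff i s) = S.coeff i s := by
  rw [coeff, map_prod]
  refine Finset.prod_congr rfl fun j hj => ?_
  have hkj : k ≠ j := fun e => hks (e ▸ hj)
  simp [map_shiftRatio, S.σ_t, S.σ_x_of_ne hki, S.σ_x_of_ne hkj]

lemma coeff_insert {i j : ι} {s : Finset ι} (hj : j ∉ s) :
    S.coeff i (insert j s) = shiftRatio S.t (S.x i) (S.x j) * S.coeff i s :=
  Finset.prod_insert hj

variable [Fintype ι]

/-- The difference operator `a ↦ coeff i {i}ᶜ * σ i a`. -/
def diffOp (i : ι) : K →+ K :=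
  (AddMonoidHom.mulLeft (S.coeff i {i}ᶜ)).comp (S.σ i).toAddMonoidHom

lemma diffOp_apply (i : ι) (a : K) : S.diffOp i a = S.coeff i {i}ᶜ * S.σ i a := rfl

lemma diffOp_mul (i : ι) (a b : K) : S.diffOp i (a * b) = S.σ i a * S.diffOp i b := by
  simp only [diffOp_apply, map_mul]; ring

/-- The `(i, j, k)` summand of `[f₀, [f₀, f₁]]` with `f_n = ∑ i, x i ^ n * diffOp i`. -/
def serreTerm (i j k : ι) (a : K) : K :=
  S.diffOp i (S.diffOp j (S.x k * S.diffOp k a))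
    - 2 * S.diffOp i (S.x j * S.diffOp j (S.diffOp k a))
    + S.x i * S.diffOp i (S.diffOp j (S.diffOp k a))

lemma serreTerm_self (i : ι) (a : K) : S.serreTerm i i i a = 0 := by
  simp only [serreTerm, diffOp_mul, map_sub, σ_x_self, S.σ_h]
  ring

lemma serreTerm_add_of_ne {i k : ι} (hik : i ≠ k) (a : K) :
    S.serreTerm i i k a + S.serreTerm i k i a + S.serreTerm k i i a = 0 := by
  have hki := hik.symm
  set s : Finset ι := {i, k}ᶜ with hs
  have his : i ∉ s := by simp [hs]
  have hks : k ∉ s := by simp [hs]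
  have ei : ({i}ᶜ : Finset ι) = insert k s := by
    ext m; by_cases m = k <;> simp_all
  have ek : ({k}ᶜ : Finset ι) = insert i s := by
    ext m; by_cases m = i <;> simp_all
  have hA := S.coeff_insert (i := i) hks
  have hB := S.coeff_insert (i := k) his
  have c1 : S.σ k (S.coeff i s) = S.coeff i s := S.σ_coeff hki hks
  have c2 : S.σ i (S.coeff k s) = S.coeff k s := S.σ_coeff hik his
  have c3 : S.σ k (S.σ i (S.coeff i s)) = S.σ i (S.coeff i s) := by rw [S.σ_comm, c1]
  have e1 : S.σ i (S.σ k (S.σ i a)) = S.σ i (S.σ i (S.σ k a)) := by rw [S.σ_comm k i]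
  have e2 : S.σ k (S.σ i (S.σ i a)) = S.σ i (S.σ i (S.σ k a)) := by
    rw [S.σ_comm k i, S.σ_comm k i]
  have n0 := S.sub_add_ne_zero i k hik 0
  have n1 := S.sub_add_ne_zero i k hik 1
  have n2 := S.sub_add_ne_zero i k hik (-1)
  have n3 := S.sub_add_ne_zero i k hik (-2)
  simp only [serreTerm, diffOp_apply, ei, ek, hA, hB, map_mul, map_shiftRatio, map_sub,
    σ_x_self, S.σ_x_of_ne hik, S.σ_x_of_ne hki, S.σ_h, S.σ_t, c1, c2, c3, e1, e2]
  simp only [Int.cast_zero, Int.cast_one, Int.cast_neg, Int.cast_ofNat, zero_mul, one_mul,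
    neg_mul, add_zero, ← sub_eq_add_neg] at n0 n1 n2 n3
  generalize S.σ i (S.σ i (S.σ k a)) = b
  generalize S.σ i (S.coeff i s) = p
  generalize S.coeff i s = q
  generalize S.coeff k s = r
  linear_combination q * p * r * b *
    serre_identity_repeated (t := S.t) n0 n1 n2 n3

lemma serreTerm_add_of_ne₃ {i j k : ι} (hij : i ≠ j) (hik : i ≠ k) (hjk : j ≠ k) (a : K) :
    S.serreTerm i j k a + S.serreTerm i k j a + S.serreTerm j i k a + S.serreTerm j k i a
      + S.serreTerm k i j a + S.serreTerm k j i a = 0 := by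
  have hji := hij.symm
  have hki := hik.symm
  have hkj := hjk.symm
  set s : Finset ι := {i, j, k}ᶜ with hs
  have his : i ∉ s := by simp [hs]
  have hjs : j ∉ s := by simp [hs]
  have hks : k ∉ s := by simp [hs]
  have ei : ({i}ᶜ : Finset ι) = insert j (insert k s) := by
    ext m; by_cases m = j <;> by_cases m = k <;> simp_all
  have ej : ({j}ᶜ : Finset ι) = insert i (insert k s) := by
    ext m; by_cases m = i <;> by_cases m = k <;> simp_all
  have ek : ({k}ᶜ : Finset ι) = insert i (insert j s) := by
    ext m; by_cases m = i <;> by_cases m = j <;> simp_all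
  have hA : S.coeff i {i}ᶜ = shiftRatio S.t (S.x i) (S.x j)
      * (shiftRatio S.t (S.x i) (S.x k) * S.coeff i s) := by
    rw [ei, coeff_insert, coeff_insert] <;> simp [hjs, hks, hjk]
  have hB : S.coeff j {j}ᶜ = shiftRatio S.t (S.x j) (S.x i)
      * (shiftRatio S.t (S.x j) (S.x k) * S.coeff j s) := by
    rw [ej, coeff_insert, coeff_insert] <;> simp [his, hks, hik]
  have hC : S.coeff k {k}ᶜ = shiftRatio S.t (S.x k) (S.x i)
      * (shiftRatio S.t (S.x k) (S.x j) * S.coeff k s) := by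
    rw [ek, coeff_insert, coeff_insert] <;> simp [his, hjs, hij]
  have c1 : S.σ j (S.coeff i s) = S.coeff i s := S.σ_coeff hji hjs
  have c2 : S.σ k (S.coeff i s) = S.coeff i s := S.σ_coeff hki hks
  have c3 : S.σ i (S.coeff j s) = S.coeff j s := S.σ_coeff hij his
  have c4 : S.σ k (S.coeff j s) = S.coeff j s := S.σ_coeff hkj hks
  have c5 : S.σ i (S.coeff k s) = S.coeff k s := S.σ_coeff hik his
  have c6 : S.σ j (S.coeff k s) = S.coeff k s := S.σ_coeff hjk hjs
  have e1 : S.σ i (S.σ k (S.σ j a)) = S.σ i (S.σ j (S.σ k a)) := by rw [S.σ_comm k j]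
  have e2 : S.σ j (S.σ i (S.σ k a)) = S.σ i (S.σ j (S.σ k a)) := by rw [S.σ_comm j i]
  have e3 : S.σ j (S.σ k (S.σ i a)) = S.σ i (S.σ j (S.σ k a)) := by
    rw [S.σ_comm k i, S.σ_comm j i]
  have e4 : S.σ k (S.σ i (S.σ j a)) = S.σ i (S.σ j (S.σ k a)) := by
    rw [S.σ_comm k i, S.σ_comm k j]
  have e5 : S.σ k (S.σ j (S.σ i a)) = S.σ i (S.σ j (S.σ k a)) := by
    rw [S.σ_comm j i, S.σ_comm k i, S.σ_comm k j]
  simp only [serreTerm, diffOp_apply, hA, hB, hC, map_mul, map_shiftRatio, map_sub,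
    σ_x_self, S.σ_x_of_ne hij, S.σ_x_of_ne hik, S.σ_x_of_ne hjk, S.σ_x_of_ne hji,
    S.σ_x_of_ne hki, S.σ_x_of_ne hkj, S.σ_h, S.σ_t, c1, c2, c3, c4, c5, c6, e1, e2, e3, e4, e5]
  have hne (l m : ι) (hlm : l ≠ m) : (S.x l - S.x m) * (S.x l - S.x m - S.h)
      * (S.x l - S.x m + S.h) ≠ 0 := by
    have n0 := S.sub_add_ne_zero l m hlm 0
    have n1 := S.sub_add_ne_zero l m hlm 1
    have n2 := S.sub_add_ne_zero l m hlm (-1)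
    simp only [Int.cast_zero, Int.cast_one, Int.cast_neg, zero_mul, one_mul, neg_mul, add_zero,
      ← sub_eq_add_neg] at n0 n1 n2
    exact mul_ne_zero (mul_ne_zero n0 n2) n1
  generalize S.σ i (S.σ j (S.σ k a)) = b
  generalize S.coeff i s = p
  generalize S.coeff j s = q
  generalize S.coeff k s = r
  have H := serre_identity S.t (hne i j hij) (hne i k hik) (hne j k hjk)
  simp only [serreFactor] at H
  linear_combination p * q * r * b * H

lemma serreTerm_symm (i j k : ι) (a : K) :
    S.serreTerm i j k a + S.serreTerm i k j a + S.serreTerm j i k a + S.serreTerm j k i a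
      + S.serreTerm k i j a + S.serreTerm k j i a = 0 := by
  by_cases hij : i = j
  · subst hij
    by_cases hik : i = k
    · subst hik
      simp [serreTerm_self]
    · linear_combination 2 * S.serreTerm_add_of_ne hik a
  by_cases hik : i = k
  · subst hik
    linear_combination 2 * S.serreTerm_add_of_ne hij a
  by_cases hjk : j = k
  · subst hjk
    linear_combination 2 * S.serreTerm_add_of_ne (Ne.symm hij) a
  exact S.serreTerm_add_of_ne₃ hij hik hjk a

lemma sum_serreTerm [CharZero K] (a : K) : ∑ i, ∑ j, ∑ k, S.serreTerm i j k a = 0 := by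
  have key : ∑ i, ∑ j, ∑ k, (S.serreTerm i j k a + S.serreTerm i k j a + S.serreTerm j i k a
      + S.serreTerm j k i a + S.serreTerm k i j a + S.serreTerm k j i a) = 0 := by
    simp only [serreTerm_symm, Finset.sum_const_zero]
  simp only [Finset.sum_add_distrib] at key
  have swap₂₃ (F : ι → ι → ι → K) : ∑ i, ∑ j, ∑ k, F i k j = ∑ i, ∑ j, ∑ k, F i j k :=
    Finset.sum_congr rfl fun i _ => Finset.sum_comm
  have swap₁₂ (F : ι → ι → ι → K) : ∑ i, ∑ j, ∑ k, F j i k = ∑ i, ∑ j, ∑ k, F i j k :=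
    Finset.sum_comm
  have h1 := swap₂₃ fun i j k => S.serreTerm i j k a
  have h2 := swap₁₂ fun i j k => S.serreTerm i j k a
  have h3 := swap₂₃ fun i j k => S.serreTerm j i k a
  have h4 := swap₁₂ fun i j k => S.serreTerm i k j a
  have h5 := swap₂₃ fun i j k => S.serreTerm j k i a
  rw [h5, h4, h3, h2, h1] at key
  have h6 : (6 : K) * ∑ i, ∑ j, ∑ k, S.serreTerm i j k a = 0 := by
    linear_combination key
  simpa using h6

end ShiftSystem

lemma ww_sub_add_ne_zero (N : ℕ) {i j : Fin N} (hij : i ≠ j) (c : k0 0) :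
    ww 0 N i - ww 0 N j + algebraMap (k0 0) (KK 0 N) c ≠ 0 := by
  have hinj := IsFractionRing.injective (MvPolynomial (Fin N) (k0 0)) (KK 0 N)
  rw [IsScalarTower.algebraMap_apply (k0 0) (MvPolynomial (Fin N) (k0 0)) (KK 0 N), ww, ww,
    ← map_sub, ← map_add, Ne, map_eq_zero_iff _ hinj]
  intro h
  have h0 := congrArg (MvPolynomial.eval fun m => if m = i then 1 - c else 0) h
  simp [MvPolynomial.algebraMap_eq, hij.symm] at h0

lemma algHom_ext_ww {N : ℕ} {f g : KK 0 N →ₐ[k0 0] KK 0 N}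
    (h : ∀ i, f (ww 0 N i) = g (ww 0 N i)) : f = g := by
  refine IsLocalization.algHom_ext (nonZeroDivisors (MvPolynomial (Fin N) (k0 0))) ?_
  refine MvPolynomial.algHom_ext fun i => ?_
  exact h i

lemma symm_ww {N : ℕ} {u : Fin N → (KK 0 N ≃ₐ[k0 0] KK 0 N)}
    (hu : ∀ i j, u i (ww 0 N j) = ww 0 N j + if j = i then hbar 0 N else 0) (i j : Fin N) :
    (u i).symm (ww 0 N j) = ww 0 N j - if j = i then hbar 0 N else 0 := by
  rw [AlgEquiv.symm_apply_eq, map_sub, hu]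
  split_ifs <;> simp [hbar]

/-- The shift system underlying the operators `fop N u n`. -/
def wbarShiftSystem (N : ℕ) (u : Fin N → (KK 0 N ≃ₐ[k0 0] KK 0 N))
    (hu : ∀ i j, u i (ww 0 N j) = ww 0 N j + if j = i then hbar 0 N else 0) :
    ShiftSystem (Fin N) (KK 0 N) where
  x := wbar N
  h := hbar 0 N
  t := tt 0 N
  σ i := ((u i).symm : KK 0 N →+* KK 0 N)
  σ_x i j := by
    simp [wbar, symm_ww hu, tt]
    ring
  σ_h i := by simp [hbar]
  σ_t i := by simp [tt]
  σ_comm i j a := by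
    have h : (u i).symm.toAlgHom.comp (u j).symm.toAlgHom
        = (u j).symm.toAlgHom.comp (u i).symm.toAlgHom := by
      refine algHom_ext_ww fun m => ?_
      change (u i).symm ((u j).symm (ww 0 N m)) = (u j).symm ((u i).symm (ww 0 N m))
      simp only [symm_ww hu, map_sub]
      split_ifs <;> simp [hbar]
    exact DFunLike.congr_fun h a
  sub_add_ne_zero i j hij n := by
    have := ww_sub_add_ne_zero N hij (n * hb0 0)
    simpa [wbar, hbar] using this

lemma fop_apply {N : ℕ} {u : Fin N → (KK 0 N ≃ₐ[k0 0] KK 0 N)}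
    (hu : ∀ i j, u i (ww 0 N j) = ww 0 N j + if j = i then hbar 0 N else 0)
    (n : ℕ) (a : KK 0 N) :
    fop N u n a = ∑ i, wbar N i ^ n * (wbarShiftSystem N u hu).diffOp i a := by
  simp only [fop, LinearMap.sum_apply, Module.End.mul_apply, mulOp, LinearMap.mulLeft_apply,
    mul_assoc]
  rfl

theorem statement9 (hN : 1 ≤ N)
    (hu : ∀ i j, u i (ww 0 N j) = ww 0 N j + if j = i then hbar 0 N else 0) :
    fop N u 0 * (fop N u 0 * fop N u 1 - fop N u 1 * fop N u 0)
      - (fop N u 0 * fop N u 1 - fop N u 1 * fop N u 0) * fop N u 0 = 0 := by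
  ext a
  have key := (wbarShiftSystem N u hu).sum_serreTerm a
  have hx : (wbarShiftSystem N u hu).x = wbar N := rfl
  simp only [ShiftSystem.serreTerm, Finset.sum_add_distrib, Finset.sum_sub_distrib,
    ← Finset.mul_sum, ← map_sum, hx] at key
  simp only [LinearMap.sub_apply, Module.End.mul_apply, map_sub, LinearMap.zero_apply,
    Finset.sum_sub_distrib, fop_apply hu, pow_zero, pow_one, one_mul]
  linear_combination key
end
end
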